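/- Lemma (DWPF convolution): with K_n(ū|v̄) = Δ'_n(ū) Δ_n(v̄) h(ū,v̄) det_n t(u_j,v_k), for sets ū (size m1), v̄ (size m2), w̄ (size m1+m2): ∑ K_{m1}(w̄_I | ū) K_{m2}(v̄ | w̄_II) f(w̄_II, w̄_I) = (-1)^{m1} f(w̄, ū) K_{m1+m2}({ū - c, v̄} | w̄), where the sum is over all partitions of w̄ into w̄_I of size m1 and w̄_II of size m2, ū - c means each element shifted by -c, and f, h, t, g applied to sets denote products. -/

import Mathlib

open Finset

noncomputable def gg (c u v : ℂ) : ℂ := c / (u - v)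
noncomputable def ff (c u v : ℂ) : ℂ := (u - v + c) / (u - v)
noncomputable def hh (c u v : ℂ) : ℂ := (u - v + c) / c
noncomputable def tt (c u v : ℂ) : ℂ := gg c u v / hh c u v

/-- The domain wall partition function `K_n(ū|v̄)`. -/
noncomputable def KK (c : ℂ) {n : ℕ} (u v : Fin n → ℂ) : ℂ :=
  (∏ j, ∏ k ∈ univ.filter (fun k => j < k), gg c (u j) (u k)) *
  (∏ j, ∏ k ∈ univ.filter (fun k => k < j), gg c (v j) (v k)) *
  (∏ j, ∏ k, hh c (u j) (v k)) *
  Matrix.det (Matrix.of fun j k => tt c (u j) (v k))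

theorem delta_cons (c : ℂ) {n : ℕ} (y : ℂ) (x : Fin n → ℂ) :
    (∏ j, ∏ k ∈ univ.filter (fun k => j < k),
      gg c ((Fin.cons y x : Fin (n+1) → ℂ) j) ((Fin.cons y x : Fin (n+1) → ℂ) k)) =
    (∏ i, gg c y (x i)) * ∏ j, ∏ k ∈ univ.filter (fun k => j < k), gg c (x j) (x k) := by
  simp only [Finset.prod_filter]
  rw [Fin.prod_univ_succ]
  congr 1
  · rw [Fin.prod_univ_succ]; simp
  · refine Finset.prod_congr rfl fun j _ => ?_
    rw [Fin.prod_univ_succ]; simp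

theorem gg_swap (c a b : ℂ) : gg c a b = - gg c b a := by
  unfold gg; rw [← neg_sub b a, div_neg]

theorem delta_succAbove (c : ℂ) {n : ℕ} (w : Fin (n+1) → ℂ) (j : Fin (n+1)) :
    (∏ a, ∏ b ∈ univ.filter (fun b => b < a), gg c (w a) (w b)) =
    (-1) ^ (j : ℕ) * (∏ k, gg c (w (j.succAbove k)) (w j)) *
      ∏ a, ∏ b ∈ univ.filter (fun b => b < a),
        gg c (w (j.succAbove a)) (w (j.succAbove b)) := by
  simp only [Finset.prod_filter]
  rw [Fin.prod_univ_succAbove _ j, Fin.prod_univ_succAbove _ j]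
  simp only [Fin.prod_univ_succAbove (fun b => if b < j.succAbove _ then _ else _) j,
    Finset.prod_mul_distrib, lt_irrefl, if_false, one_mul, Fin.succAbove_lt_succAbove_iff]
  rw [← mul_assoc]
  congr 1
  have hs : ((-1 : ℂ)) ^ (j : ℕ) = ∏ k : Fin n, if j.succAbove k < j then (-1 : ℂ) else 1 := by
    rw [← Finset.prod_filter, Finset.prod_const]
    congr 1
    simp only [Fin.succAbove_lt_iff_castSucc_lt]
    have := Fin.card_filter_val_lt (n := n) (m := (j:ℕ))
    simp only [Fin.lt_def, Fin.val_castSucc]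
    rw [this]; omega
  rw [hs, ← Finset.prod_mul_distrib, ← Finset.prod_mul_distrib]
  refine Finset.prod_congr rfl fun k _ => ?_
  rcases lt_or_gt_of_ne (Fin.succAbove_ne j k) with h | h
  · simp [h, h.not_gt, gg_swap c (w j)]
  · simp [h, h.not_gt]

theorem pfrac {n : ℕ} (X w : Fin n → ℂ) (hX : Function.Injective X) (z : ℂ)
    (hz : ∀ i, z - X i ≠ 0) :
    (∏ k, (z - w k)) / (∏ k, (z - X k)) =
      1 + ∑ i, (∏ k, (X i - w k)) * (∏ k ∈ univ.erase i, (X i - X k)⁻¹) * (z - X i)⁻¹ := by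
  classical
  have hne : (∏ k, (z - X k)) ≠ 0 := Finset.prod_ne_zero_iff.2 fun i _ => hz i
  have hdeg : (Lagrange.nodal univ w - Lagrange.nodal univ X).degree
      < ((univ : Finset (Fin n)).card : ℕ) := by
    rcases Nat.eq_zero_or_pos n with h | h
    · subst h; simp
    have := Polynomial.degree_sub_lt_left (p := Lagrange.nodal univ w) (q := Lagrange.nodal univ X)
      (by rw [Lagrange.degree_nodal, Lagrange.degree_nodal]) Lagrange.nodal_ne_zero
      (by rw [Lagrange.nodal_monic, Lagrange.nodal_monic])
    rwa [Lagrange.degree_nodal] at this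
  have h1 := Lagrange.eq_interpolate_of_eval_eq (s := univ) (v := X)
    (fun i => ∏ k, (X i - w k)) hX.injOn hdeg (by
      intro i _
      rw [Polynomial.eval_sub, Lagrange.eval_nodal, Lagrange.eval_nodal_at_node (mem_univ i)]
      simp)
  have h2 := congrArg (Polynomial.eval z) h1
  rw [Lagrange.eval_interpolate_not_at_node _ (fun i _ => sub_ne_zero.1 (hz i)),
    Polynomial.eval_sub, Lagrange.eval_nodal, Lagrange.eval_nodal] at h2
  rw [div_eq_iff hne, add_mul, one_mul, ← sub_eq_iff_eq_add', h2, mul_comm]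
  congr 1
  refine Finset.sum_congr rfl fun i _ => ?_
  simp only [Lagrange.nodalWeight]; ring

theorem rowid (c : ℂ) (hc : c ≠ 0) {n : ℕ} (X w : Fin n → ℂ) (hX : Function.Injective X)
    (h1 : ∀ i j, X i - w j ≠ 0) (h2 : ∀ i j, X i - w j + c ≠ 0) (j : Fin n) :
    (∏ k, hh c (w k) (w j)) / (∏ k, hh c (X k) (w j)) =
      ∑ i, ((∏ k ∈ univ.erase i, gg c (X i) (X k)) / ∏ k, gg c (X i) (w k)) *
        tt c (X i) (w j) := by
  have e1 := pfrac X w hX (w j) (fun i h => h1 i j (by rw [← neg_sub, h, neg_zero]))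
  have e2 := pfrac X w hX (w j - c) (fun i h => h2 i j (by linear_combination -h))
  rw [Finset.prod_eq_zero (mem_univ j) (sub_self _), zero_div] at e1
  have e3 : (∏ k, hh c (w k) (w j)) / (∏ k, hh c (X k) (w j)) =
      (∏ k, (w j - c - w k)) / (∏ k, (w j - c - X k)) := by
    rw [← Finset.prod_div_distrib, ← Finset.prod_div_distrib]
    refine Finset.prod_congr rfl fun k _ => ?_
    unfold hh
    rw [div_div_div_cancel_right₀ hc, ← neg_div_neg_eq]
    congr 1 <;> ring
  rw [e3, e2]
  rw [← sub_zero (1 + _), e1, add_sub_add_left_eq_sub, ← Finset.sum_sub_distrib]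
  refine Finset.sum_congr rfl fun i _ => ?_
  have hp : (∏ k ∈ univ.erase i, gg c (X i) (X k)) / ∏ k, gg c (X i) (w k) =
      (∏ k, (X i - w k)) * (∏ k ∈ univ.erase i, (X i - X k)⁻¹) / c := by
    unfold gg
    rw [Finset.prod_div_distrib, Finset.prod_div_distrib, Finset.prod_const, Finset.prod_const,
      Finset.card_erase_of_mem (mem_univ i), Finset.prod_inv_distrib]
    have : (univ : Finset (Fin n)).card = (univ : Finset (Fin n)).card - 1 + 1 := by
      have := Finset.card_pos.2 ⟨i, mem_univ i⟩; omega
    rw [this, pow_succ, Nat.add_sub_cancel]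
    have hA : ∏ k, (X i - w k) ≠ 0 := Finset.prod_ne_zero_iff.2 fun k _ => h1 i k
    have hB : ∏ k ∈ univ.erase i, (X i - X k) ≠ 0 := Finset.prod_ne_zero_iff.2 fun k hk =>
      sub_ne_zero.2 fun h => (Finset.ne_of_mem_erase hk) (hX h).symm
    field_simp
  rw [hp, ← mul_sub, div_mul_eq_mul_div, mul_div_assoc]
  congr 1
  have a1 := h1 i j
  have a2 := h2 i j
  have a3 : w j - X i ≠ 0 := by rw [← neg_sub]; exact neg_ne_zero.2 a1
  have a4 : w j - c - X i ≠ 0 := by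
    intro h; exact a2 (by linear_combination -h)
  unfold tt gg hh
  rw [show w j - c - X i = -(X i - w j + c) by ring, show w j - X i = -(X i - w j) by ring]
  field_simp
  ring

/-- main recursion -/
theorem KK_rec (c : ℂ) (hc : c ≠ 0) {n : ℕ} (y : ℂ) (x : Fin n → ℂ) (w : Fin (n+1) → ℂ)
    (hX : Function.Injective (Fin.cons y x : Fin (n+1) → ℂ))
    (h1 : ∀ i j, (Fin.cons y x : Fin (n+1) → ℂ) i - w j ≠ 0)
    (h2 : ∀ i j, (Fin.cons y x : Fin (n+1) → ℂ) i - w j + c ≠ 0) :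
    -(∏ j, ff c (w j) (y + c)) * KK c (Fin.cons y x : Fin (n+1) → ℂ) w =
    ∑ j, gg c (w j) (y + c) * (∏ k, ff c (w (j.succAbove k)) (w j)) *
      KK c x (fun k => w (j.succAbove k)) := by
  set X : Fin (n+1) → ℂ := Fin.cons y x with hXd
  set M : Matrix (Fin (n+1)) (Fin (n+1)) ℂ := Matrix.of fun j k => tt c (X j) (w k) with hM
  have hX0 : X 0 = y := rfl
  have hXs : ∀ i, X (Fin.succ i) = x i := fun i => rfl
  have hdet : (∑ j : Fin (n+1), (-1 : ℂ) ^ (j : ℕ) *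
        ((∏ k, hh c (w k) (w j)) / (∏ k, hh c (X k) (w j))) *
        (M.submatrix Fin.succ j.succAbove).det) =
      ((∏ i, gg c y (x i)) / ∏ k, gg c y (w k)) * M.det := by
    have := Matrix.det_updateRow_sum M 0
      (fun i => (∏ k ∈ univ.erase i, gg c (X i) (X k)) / ∏ k, gg c (X i) (w k))
    rw [Matrix.det_succ_row_zero] at this
    rw [smul_eq_mul, hX0] at this
    have e0 : ∏ k ∈ univ.erase (0 : Fin (n+1)), gg c y (X k) = ∏ i, gg c y (x i) := by
      have : (univ.erase (0 : Fin (n+1))) = univ.map (Fin.succEmb n) := by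
        ext k; simp [Fin.exists_succ_eq]
      rw [this, Finset.prod_map]; rfl
    rw [e0] at this
    rw [← this]
    refine Finset.sum_congr rfl fun j _ => ?_
    rw [rowid c hc X w hX h1 h2 j]
    congr 2
    · simp [hM, Finset.sum_apply]
  have hA : ∀ j, gg c (w j) (y + c) * (∏ k, ff c (w (j.succAbove k)) (w j)) *
      KK c x (fun k => w (j.succAbove k)) =
      (-(∏ j, ∏ k ∈ univ.filter (fun k => j < k), gg c (x j) (x k)) *
      (∏ j, ∏ k ∈ univ.filter (fun k => k < j), gg c (w j) (w k)) *
      (∏ j, ∏ k, hh c (x j) (w k))) * ((-1 : ℂ) ^ (j : ℕ) *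
        ((∏ k, hh c (w k) (w j)) / (∏ k, hh c (X k) (w j))) *
        (M.submatrix Fin.succ j.succAbove).det) := by
    intro j
    unfold KK
    rw [delta_succAbove c w j]
    have ef : ∏ k, ff c (w (j.succAbove k)) (w j) =
      (∏ k, gg c (w (j.succAbove k)) (w j)) * ∏ k, hh c (w (j.succAbove k)) (w j) := by
      rw [← Finset.prod_mul_distrib]
      refine Finset.prod_congr rfl fun k _ => ?_
      unfold ff gg hh; rw [mul_comm, div_mul_div_comm, mul_comm c, mul_div_mul_right _ _ hc]
    have eh : ∏ k, hh c (w k) (w j) = ∏ k, hh c (w (j.succAbove k)) (w j) := by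
      rw [Fin.prod_univ_succAbove _ j]
      simp [hh, div_self hc]
    have eX : ∏ k, hh c (X k) (w j) = hh c y (w j) * ∏ i, hh c (x i) (w j) := by
      rw [Fin.prod_univ_succ]; rfl
    have ex : ∏ i, ∏ k, hh c (x i) (w k) =
        (∏ i, hh c (x i) (w j)) * ∏ i, ∏ k, hh c (x i) (w (j.succAbove k)) := by
      rw [← Finset.prod_mul_distrib]
      refine Finset.prod_congr rfl fun k _ => ?_
      rw [Fin.prod_univ_succAbove _ j]
    have ey : gg c (w j) (y + c) = - (hh c y (w j))⁻¹ := by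
      unfold gg hh
      rw [inv_div, ← div_neg]; congr 1; ring
    have em : (M.submatrix Fin.succ j.succAbove) =
      Matrix.of fun a b => tt c (x a) (w (j.succAbove b)) := by
      ext a b; simp [hM, hXs]
    have hx0 : ∏ i, hh c (x i) (w j) ≠ 0 :=
      Finset.prod_ne_zero_iff.2 fun i _ => div_ne_zero (by simpa [hXs] using h2 i.succ j) hc
    have hy0 : hh c y (w j) ≠ 0 := div_ne_zero (by simpa [hX0] using h2 0 j) hc
    have hs : ((-1 : ℂ) ^ (j : ℕ)) * (-1) ^ (j : ℕ) = 1 := by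
      rw [← mul_pow]; simp
    rw [ef, eh, eX, ex, ey, em]
    generalize Matrix.det (Matrix.of fun a b => tt c (x a) (w (j.succAbove b))) = D
    rcases neg_one_pow_eq_or ℂ (j : ℕ) with h | h <;> rw [h] <;> field_simp
  rw [Finset.sum_congr rfl fun j _ => hA j, ← Finset.mul_sum, hdet]
  unfold KK
  rw [hXd, delta_cons, ← hXd]
  have eX : ∏ i, ∏ k, hh c (X i) (w k) =
      (∏ k, hh c y (w k)) * ∏ i, ∏ k, hh c (x i) (w k) := by
    rw [Fin.prod_univ_succ]; rfl
  have ef : (∏ j, ff c (w j) (y + c)) * ∏ k, hh c y (w k) = (∏ k, gg c y (w k))⁻¹ := by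
    rw [← Finset.prod_mul_distrib, ← Finset.prod_inv_distrib]
    refine Finset.prod_congr rfl fun k _ => ?_
    have a1 : y - w k ≠ 0 := by simpa [hX0] using h1 0 k
    have a2 : y - w k + c ≠ 0 := by simpa [hX0] using h2 0 k
    unfold ff hh gg
    rw [show w k - (y + c) = -(y - w k + c) by ring]
    field_simp
    ring
  rw [eX, div_eq_mul_inv, ← ef]
  ring

theorem delta_rev (c : ℂ) {n : ℕ} (x : Fin n → ℂ) :
    (∏ j, ∏ k ∈ univ.filter (fun k => k < j), gg c (x j) (x k)) =
    (∏ j : Fin n, ∏ k ∈ univ.filter (fun k => j < k), (-1 : ℂ)) *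
      ∏ j, ∏ k ∈ univ.filter (fun k => j < k), gg c (x j) (x k) := by
  rw [← Finset.prod_mul_distrib]
  simp only [← Finset.prod_mul_distrib]
  simp only [Finset.prod_filter]
  rw [Finset.prod_comm]
  refine Finset.prod_congr rfl fun j _ => Finset.prod_congr rfl fun k _ => ?_
  split_ifs
  · rw [gg_swap]; ring
  · rfl

theorem KK_swap (c : ℂ) (hc : c ≠ 0) {n : ℕ} (w u : Fin n → ℂ)
    (h1 : ∀ i j, w i - u j ≠ 0) :
    KK c w u = (-1) ^ n * (∏ i, ∏ j, ff c (w i) (u j)) * KK c (fun j => u j - c) w := by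
  unfold KK
  rw [delta_rev c u, delta_rev c w]
  have e1 : ∀ j k, gg c (u j - c) (u k - c) = gg c (u j) (u k) := by
    intro j k; unfold gg; congr 1; ring
  have e2 : (∏ j, ∏ k, hh c (w j) (u k)) = (-1) ^ n * (∏ i, ∏ j, ff c (w i) (u j)) *
      (∏ j, ∏ k, hh c (u j - c) (w k)) := by
    have : ((-1 : ℂ)) ^ n = ∏ i : Fin n, ∏ j : Fin n, (-1 : ℂ) := by
      simp only [Finset.prod_const, Finset.card_univ, Fintype.card_fin]
      rcases neg_one_pow_eq_or ℂ n with h | h <;> rw [h]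
      · simp
      · rw [h]
    rw [this, Finset.prod_comm (f := fun j k => hh c (u j - c) (w k)),
      ← Finset.prod_mul_distrib, ← Finset.prod_mul_distrib]
    refine Finset.prod_congr rfl fun j _ => ?_
    rw [← Finset.prod_mul_distrib, ← Finset.prod_mul_distrib]
    refine Finset.prod_congr rfl fun k _ => ?_
    have := h1 j k
    unfold hh ff
    rw [show u k - c - w j + c = -(w j - u k) by ring]
    field_simp
  have e3 : Matrix.det (Matrix.of fun j k => tt c (w j) (u k)) =
      Matrix.det (Matrix.of fun j k => tt c (u j - c) (w k)) := by
    rw [← Matrix.det_transpose]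
    congr 1
    ext a b
    simp only [Matrix.transpose_apply, Matrix.of_apply]
    unfold tt gg hh
    rw [div_div_div_eq, div_div_div_eq]
    congr 1; ring
  simp only [e1]
  rw [e2, e3]
  ring

/-- `K` with second argument indexed by a finite set of indices. -/
noncomputable def Kf (c : ℂ) {N n : ℕ} (w : Fin N → ℂ) (x : Fin n → ℂ)
    (T : Finset (Fin N)) : ℂ :=
  if h : T.card = n then KK c x (fun i => w (T.orderEmbOfFin h i)) else 0

theorem Kf_cast (c : ℂ) {N n m : ℕ} (w : Fin N → ℂ) (h : n = m) (x : Fin m → ℂ)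
    (T : Finset (Fin N)) : Kf c w (x ∘ Fin.cast h) T = Kf c w x T := by
  subst h; rfl

theorem emb_erase {N n : ℕ} (T : Finset (Fin N)) (h : T.card = n + 1) (j : Fin (n+1))
    (h' : (T.erase (T.orderEmbOfFin h j)).card = n) (k : Fin n) :
    (T.erase (T.orderEmbOfFin h j)).orderEmbOfFin h' k =
      T.orderEmbOfFin h (j.succAbove k) := by
  have := Finset.orderEmbOfFin_unique h' (f := fun k => T.orderEmbOfFin h (j.succAbove k))
    (fun k => by
      rw [Finset.mem_erase]
      refine ⟨fun e => Fin.succAbove_ne j k ((T.orderEmbOfFin h).injective e),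
        Finset.orderEmbOfFin_mem _ _ _⟩)
    ((T.orderEmbOfFin h).strictMono.comp (Fin.strictMono_succAbove j))
  exact (congrFun this k).symm

theorem sum_emb {N n : ℕ} (T : Finset (Fin N)) (h : T.card = n) (F : Fin N → ℂ) :
    ∑ i, F (T.orderEmbOfFin h i) = ∑ i ∈ T, F i := by
  conv_rhs => rw [← Finset.image_orderEmbOfFin_univ T h]
  rw [Finset.sum_image fun a _ b _ e => (T.orderEmbOfFin h).injective e]

theorem prod_emb {N n : ℕ} (T : Finset (Fin N)) (h : T.card = n) (F : Fin N → ℂ) :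
    ∏ i, F (T.orderEmbOfFin h i) = ∏ i ∈ T, F i := by
  conv_rhs => rw [← Finset.image_orderEmbOfFin_univ T h]
  rw [Finset.prod_image fun a _ b _ e => (T.orderEmbOfFin h).injective e]

theorem Kf_rec (c : ℂ) (hc : c ≠ 0) {N n : ℕ} (y : ℂ) (x : Fin n → ℂ) (w : Fin N → ℂ)
    (hX : Function.Injective (Fin.cons y x : Fin (n+1) → ℂ))
    (h1 : ∀ i j, (Fin.cons y x : Fin (n+1) → ℂ) i - w j ≠ 0)
    (h2 : ∀ i j, (Fin.cons y x : Fin (n+1) → ℂ) i - w j + c ≠ 0) (T : Finset (Fin N)) :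
    -(∏ j ∈ T, ff c (w j) (y + c)) * Kf c w (Fin.cons y x : Fin (n+1) → ℂ) T =
    ∑ j ∈ T, gg c (w j) (y + c) * (∏ k ∈ T.erase j, ff c (w k) (w j)) *
      Kf c w x (T.erase j) := by
  by_cases h : T.card = n + 1
  · have := KK_rec c hc y x (fun i => w (T.orderEmbOfFin h i)) hX (fun i j => h1 _ _)
      (fun i j => h2 _ _)
    rw [← prod_emb T h (fun j => ff c (w j) (y + c)), Kf, dif_pos h, this,
      ← sum_emb T h]
    refine Finset.sum_congr rfl fun j _ => ?_
    have h' : (T.erase (T.orderEmbOfFin h j)).card = n := by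
      rw [Finset.card_erase_of_mem (Finset.orderEmbOfFin_mem _ _ _), h]; rfl
    rw [Kf, dif_pos h', ← prod_emb _ h']
    simp only [emb_erase]
  · rw [Kf, dif_neg h, mul_zero]
    symm
    refine Finset.sum_eq_zero fun j hj => ?_
    rw [Kf, dif_neg, mul_zero]
    rw [Finset.card_erase_of_mem hj]
    have := Finset.card_pos.2 ⟨j, hj⟩
    omega

/-- the right hand side, on a finite set of indices -/
noncomputable def Af (c : ℂ) {N m n : ℕ} (w : Fin N → ℂ) (u : Fin m → ℂ) (v : Fin n → ℂ)
    (T : Finset (Fin N)) : ℂ :=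
  (-1) ^ m * (∏ i ∈ T, ∏ j, ff c (w i) (u j)) * Kf c w (Fin.append (fun j => u j - c) v) T

theorem Af_rec (c : ℂ) (hc : c ≠ 0) {N m n : ℕ} (w : Fin N → ℂ) (u : Fin (m+1) → ℂ)
    (v : Fin n → ℂ) (hu : Function.Injective u) (hv : Function.Injective v)
    (h1 : ∀ i j, w i - u j ≠ 0) (h2 : ∀ i j, w i - u j + c ≠ 0)
    (h4 : ∀ j k, v j - w k ≠ 0) (h5 : ∀ j k, v j - w k + c ≠ 0)
    (h6 : ∀ j k, u j - c - v k ≠ 0) (T : Finset (Fin N)) :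
    Af c w u v T = ∑ j ∈ T, gg c (w j) (u 0) * (∏ k ∈ T.erase j, ff c (w k) (w j)) *
      (∏ i, ff c (w j) (u (Fin.succ i))) * Af c w (fun i => u (Fin.succ i)) v (T.erase j) := by
  have ea : (Fin.append (fun j => u j - c) v) =
      (Fin.cons (u 0 - c) (Fin.append (fun j : Fin m => u j.succ - c) v) :
        Fin (m + n + 1) → ℂ) ∘ Fin.cast (Nat.add_right_comm m 1 n) := by
    rw [← Fin.append_cons]
    congr 1
    ext j
    refine Fin.cases rfl (fun i => rfl) j
  have key : ∀ P : ℂ → Prop, (∀ j, P (u j - c)) → (∀ j, P (v j)) → ∀ i, 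
      P ((Fin.cons (u 0 - c) (Fin.append (fun j : Fin m => u j.succ - c) v) :
        Fin (m + n + 1) → ℂ) i) := by
    intro P hP hQ i
    refine Fin.cases (hP 0) (fun i => ?_) i
    rw [Fin.cons_succ]
    refine Fin.addCases (fun i => ?_) (fun i => ?_) i
    · rw [Fin.append_left]; exact hP _
    · rw [Fin.append_right]; exact hQ _
  have hX : Function.Injective (Fin.cons (u 0 - c)
      (Fin.append (fun j : Fin m => u j.succ - c) v) : Fin (m + n + 1) → ℂ) := by
    rw [Fin.cons_injective_iff, Fin.append_injective_iff]
    refine ⟨?_, fun a b e => ?_, hv, fun a b e => h6 _ _ (sub_eq_zero.2 e)⟩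
    · rintro ⟨i, hi⟩
      revert hi
      refine Fin.addCases (fun i => ?_) (fun i => ?_) i
      · rw [Fin.append_left]; intro e
        exact Fin.succ_ne_zero i (hu (sub_left_injective e))
      · rw [Fin.append_right]; intro e
        exact h6 0 i (sub_eq_zero.2 e.symm)
    · exact Fin.succ_injective _ (hu (sub_left_injective e))
  have hr := Kf_rec c hc (u 0 - c) (Fin.append (fun j : Fin m => u j.succ - c) v) w hX
    (fun i j => key (fun z => z - w j ≠ 0) (fun k e => h2 j k (by linear_combination -e))
      (fun k => h4 k j) i)
    (fun i j => key (fun z => z - w j + c ≠ 0) (fun k e => h1 j k (by linear_combination -e))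
      (fun k => h5 k j) i) T
  rw [sub_add_cancel] at hr
  unfold Af
  rw [ea, Kf_cast]
  have ep : ∏ i ∈ T, ∏ j, ff c (w i) (u j) = (∏ i ∈ T, ff c (w i) (u 0)) *
      ∏ i ∈ T, ∏ j : Fin m, ff c (w i) (u j.succ) := by
    rw [← Finset.prod_mul_distrib]
    exact Finset.prod_congr rfl fun i _ => Fin.prod_univ_succ _
  rw [ep]
  calc _ = (-1) ^ m * (∏ i ∈ T, ∏ j : Fin m, ff c (w i) (u j.succ)) *
        (-(∏ j ∈ T, ff c (w j) (u 0)) * Kf c w (Fin.cons (u 0 - c)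
      (Fin.append (fun j : Fin m => u j.succ - c) v) : Fin (m + n + 1) → ℂ) T) := by ring
    _ = _ := by
      rw [hr, Finset.mul_sum]
      refine Finset.sum_congr rfl fun j hj => ?_
      rw [← Finset.mul_prod_erase T _ hj]
      ring

theorem conv_main (c : ℂ) (hc : c ≠ 0) {N n : ℕ} (w : Fin N → ℂ) 
    (v : Fin n → ℂ) (hv : Function.Injective v)
    (h4 : ∀ j k, v j - w k ≠ 0) (h5 : ∀ j k, v j - w k + c ≠ 0) (m : ℕ) :
    ∀ (u : Fin m → ℂ) (_ : Function.Injective u)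
    (_ : ∀ i j, w i - u j ≠ 0) (_ : ∀ i j, w i - u j + c ≠ 0)
    (_ : ∀ j k, u j - c - v k ≠ 0) (T : Finset (Fin N)),
    ∑ S ∈ T.powerset, Af c w u (Fin.elim0 : Fin 0 → ℂ) S * Kf c w v (T \ S) *
      (∏ i ∈ T \ S, ∏ i' ∈ S, ff c (w i) (w i')) = Af c w u v T := by
  induction m with
  | zero =>
    intro u _ _ _ _ T
    rw [Finset.sum_eq_single ∅]
    · have e : Fin.append (fun j => u j - c) v = v ∘ Fin.cast (Nat.zero_add n) := by
        rw [← Fin.elim0_append]; congr 1; exact Subsingleton.elim _ _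
      simp only [Af, e, Kf_cast]
      simp [Kf, KK]
    · intro S _ hS
      have : Af c w u (Fin.elim0 : Fin 0 → ℂ) S = 0 := by
        unfold Af Kf
        rw [dif_neg, mul_zero]
        simpa using hS
      rw [this]; ring
    · simp
  | succ m ih =>
    intro u hu h1 h2 h6 T
    rw [Af_rec c hc w u v hu hv h1 h2 h4 h5 h6]
    have hE := fun S => Af_rec c hc w u (Fin.elim0 : Fin 0 → ℂ) hu (fun a => a.elim0) h1 h2
      (fun a => a.elim0) (fun a => a.elim0) (fun _ a => a.elim0) S
    simp only [hE, Finset.sum_mul]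
    rw [Finset.sum_sigma', ]
    simp only [← ih (fun i => u i.succ) (hu.comp (Fin.succ_injective _)) (fun i j => h1 _ _)
      (fun i j => h2 _ _) (fun i j => h6 _ _), Finset.mul_sum]
    rw [Finset.sum_sigma']
    refine Finset.sum_bij' (fun p _ => ⟨p.2, p.1.erase p.2⟩) (fun p _ => ⟨insert p.1 p.2, p.1⟩)
      ?_ ?_ ?_ ?_ ?_
    · rintro ⟨S, j⟩ h
      simp only [mem_sigma, mem_powerset] at h ⊢
      exact ⟨h.1 h.2, Finset.erase_subset_erase _ h.1⟩
    · rintro ⟨j, S⟩ h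
      simp only [mem_sigma, mem_powerset] at h ⊢
      refine ⟨Finset.insert_subset h.1 (h.2.trans (Finset.erase_subset _ _)),
        Finset.mem_insert_self _ _⟩
    · rintro ⟨S, j⟩ h
      simp only [mem_sigma, mem_powerset] at h ⊢
      rw [Finset.insert_erase h.2]
    · rintro ⟨j, S⟩ h
      simp only [mem_sigma, mem_powerset] at h ⊢
      rw [Finset.erase_insert fun e => Finset.notMem_erase _ _ (h.2 e)]
    · rintro ⟨S, j⟩ h
      simp only [mem_sigma, mem_powerset] at h ⊢
      have e1 : T.erase j \ S.erase j = T \ S := by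
        ext a
        simp only [mem_sdiff, mem_erase]
        constructor
        · rintro ⟨⟨a1, a2⟩, a3⟩; exact ⟨a2, fun a4 => a3 ⟨a1, a4⟩⟩
        · rintro ⟨a1, a2⟩
          exact ⟨⟨fun e => a2 (e ▸ h.2), a1⟩, fun a3 => a2 a3.2⟩
      have e2 : ∏ k ∈ T.erase j, ff c (w k) (w j) =
          (∏ k ∈ T \ S, ff c (w k) (w j)) * ∏ k ∈ S.erase j, ff c (w k) (w j) := by
        rw [← e1, Finset.prod_sdiff (Finset.erase_subset_erase _ h.1)]
      have e3 : (∏ i ∈ T \ S, ∏ i' ∈ S, ff c (w i) (w i')) =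
          (∏ k ∈ T \ S, ff c (w k) (w j)) *
            ∏ i ∈ T \ S, ∏ i' ∈ S.erase j, ff c (w i) (w i') := by
        rw [← Finset.prod_mul_distrib]
        exact Finset.prod_congr rfl fun i _ => (Finset.mul_prod_erase S _ h.2).symm
      rw [e1, e2, e3]
      ring

theorem dwpf_convolution (c : ℂ) (hc : c ≠ 0) (m1 m2 : ℕ)
    (u : Fin m1 → ℂ) (v : Fin m2 → ℂ) (w : Fin (m1 + m2) → ℂ)
    (hw : Function.Injective w) (hu : Function.Injective u)
    (hv : Function.Injective v)
    (h1 : ∀ i j, w i - u j ≠ 0) (h2 : ∀ i j, w i - u j + c ≠ 0)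
    (h3 : ∀ i j, w i - u j - c ≠ 0)
    (h4 : ∀ j k, v j - w k ≠ 0) (h5 : ∀ j k, v j - w k + c ≠ 0)
    (h6 : ∀ j k, u j - c - v k ≠ 0) :
    (∑ S : Finset (Fin (m1 + m2)),
        if h : S.card = m1 then
          KK c (fun i => w (S.orderEmbOfFin h i)) u *
          KK c v (fun i => w (Sᶜ.orderEmbOfFin
            (by rw [Finset.card_compl, h, Fintype.card_fin]; omega) i)) *
          (∏ i ∈ Sᶜ, ∏ i' ∈ S, ff c (w i) (w i'))
        else 0) =
      (-1 : ℂ) ^ m1 * (∏ i, ∏ j, ff c (w i) (u j)) *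
        KK c (Fin.append (fun j => u j - c) v) w := by
  have H := conv_main c hc w v hv h4 h5 m1 u hu h1 h2 h6 univ
  have hU : (univ : Finset (Fin (m1 + m2))).card = m1 + m2 := by simp
  have hid : ∀ i, (univ : Finset (Fin (m1 + m2))).orderEmbOfFin hU i = i := by
    intro i
    exact (congrFun (Finset.orderEmbOfFin_unique hU (f := id) (fun _ => mem_univ _)
      strictMono_id) i).symm
  have hR : Af c w u v univ = (-1 : ℂ) ^ m1 * (∏ i, ∏ j, ff c (w i) (u j)) *
        KK c (Fin.append (fun j => u j - c) v) w := by
    unfold Af Kf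
    rw [dif_pos hU]
    simp only [hid]
  rw [← hR, ← H, Finset.powerset_univ]
  refine Finset.sum_congr rfl fun S _ => ?_
  rw [← Finset.compl_eq_univ_sdiff]
  have eA : Af c w u (Fin.elim0 : Fin 0 → ℂ) S = (-1) ^ m1 * (∏ i ∈ S, ∏ j, ff c (w i) (u j)) *
      Kf c w (fun j => u j - c) S := by
    unfold Af
    rw [Fin.append_elim0, Kf_cast]
  split_ifs with h
  · have h' : Sᶜ.card = m2 := by rw [Finset.card_compl, h, Fintype.card_fin]; omega
    rw [eA, Kf, Kf, dif_pos h, dif_pos h', KK_swap c hc _ u (fun i j => h1 _ _),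
      prod_emb S h (fun i => ∏ j, ff c (w i) (u j))]
  · rw [eA, Kf, dif_neg h]; ring
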